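/- arXiv:2205.13981 — 2 statements merged into one kernel-verified Lean document; each statement's English description precedes it below -/
import Mathlib

section
/- Let p be an odd prime, α, β : ℕ, 𝒞 an additive subgroup of (Fin α → ZMod p) × (Fin β → ZMod (p²)), and C = Φ '' 𝒞. If u ∈ 𝒞 has p • u = 0 (i.e. u is a codeword of order dividing p), then Φ(u) ∈ K(C). In particular the Gray image of the order-p subcode 𝒞_p = {u ∈ 𝒞 : p • u = 0} is contained in the kernel of C. -/
/-- The Gray map `φ : ZMod (p²) → (Fin p → ZMod p)`. -/
def gray (p : ℕ) (θ : ZMod (p ^ 2)) : Fin p → ZMod p :=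
  fun i => ((θ.val / p : ℕ) : ZMod p) + ((θ.val % p : ℕ) : ZMod p) * ((i : ℕ) : ZMod p)

/-- The extended Gray map `Φ`. -/
def Gray (p α β : ℕ) (u : (Fin α → ZMod p) × (Fin β → ZMod (p ^ 2))) :
    (Fin α → ZMod p) × (Fin β → Fin p → ZMod p) :=
  (u.1, fun j => gray p (u.2 j))

/-- The kernel `K(C) = {x : x + C = C}` of a subset `C`. -/
def kernelSet {V : Type*} [AddCommGroup V] (C : Set V) : Set V :=
  {x | (fun c => x + c) '' C = C}

theorem gray_add (p : ℕ) (hp : p.Prime) (a b : ZMod (p ^ 2)) (ha : p • a = 0) :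
    gray p (a + b) = gray p a + gray p b := by
  have hpos := hp.pos
  have : NeZero (p ^ 2) := ⟨by positivity⟩
  obtain ⟨k, hk⟩ : p ∣ a.val := by
    have h : ((p * a.val : ℕ) : ZMod (p ^ 2)) = 0 := by
      rw [Nat.cast_mul, ZMod.natCast_zmod_val, ← nsmul_eq_mul, ha]
    rw [ZMod.natCast_eq_zero_iff] at h
    generalize a.val = x at h ⊢
    rw [pow_two] at h
    exact Nat.dvd_of_mul_dvd_mul_left hpos h
  have h1 : (a + b).val / p = (k + b.val / p) % p := by
    rw [ZMod.val_add, hk]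
    generalize b.val = y
    rw [pow_two, Nat.mod_mul_right_div_self, Nat.mul_add_div hpos]
  have h2 : (a + b).val % p = b.val % p := by
    rw [ZMod.val_add, hk]
    generalize b.val = y
    rw [pow_two, Nat.mod_mul_right_mod, Nat.mul_add_mod]
  funext i
  simp only [gray, Pi.add_apply, h1, h2]
  rw [hk, Nat.mul_div_cancel_left _ hpos, Nat.mul_mod_right, ZMod.natCast_mod]
  push_cast
  ring

theorem Gray_add (p : ℕ) (hp : p.Prime) (α β : ℕ)
    (u v : (Fin α → ZMod p) × (Fin β → ZMod (p ^ 2))) (hpu : p • u = 0) :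
    Gray p α β u + Gray p α β v = Gray p α β (u + v) := by
  refine Prod.ext rfl ?_
  funext j
  exact (gray_add p hp (u.2 j) (v.2 j) (congrFun (congrArg Prod.snd hpu) j)).symm

/-- If `u ∈ 𝒞` has `p • u = 0`, then `Φ(u)` lies in the kernel of `C = Φ '' 𝒞`. -/
theorem orderP_mem_kernel (p : ℕ) (hp : p.Prime) (hodd : Odd p) (α β : ℕ)
    (𝒞 : AddSubgroup ((Fin α → ZMod p) × (Fin β → ZMod (p ^ 2))))
    (u : (Fin α → ZMod p) × (Fin β → ZMod (p ^ 2))) (hu : u ∈ 𝒞) (hpu : p • u = 0) :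
    Gray p α β u ∈
      kernelSet (Gray p α β '' (𝒞 : Set ((Fin α → ZMod p) × (Fin β → ZMod (p ^ 2))))) := by
  unfold kernelSet
  rw [Set.mem_ofPred_eq]
  ext x
  constructor
  · rintro ⟨_, ⟨v, hv, rfl⟩, rfl⟩
    exact ⟨u + v, 𝒞.add_mem hu hv, (Gray_add p hp α β u v hpu).symm⟩
  · rintro ⟨v, hv, rfl⟩
    refine ⟨_, ⟨v - u, 𝒞.sub_mem hv hu, rfl⟩, ?_⟩
    change Gray p α β u + Gray p α β (v - u) = _
    rw [Gray_add p hp α β u _ hpu, add_sub_cancel]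
end

section
/- Let p be an odd prime, α, β, γ, δ : ℕ, and let 𝒞 be an additive subgroup of (Fin α → ZMod p) × (Fin β → ZMod (p²)) admitting an additive group isomorphism 𝒞 ≃+ (Fin γ → ZMod p) × (Fin δ → ZMod (p²)). Let C = Φ '' 𝒞. Then p^(γ+δ) ≤ Nat.card (K(C)) ≤ p^(γ+2δ); equivalently, the dimension of the kernel of C lies in {γ+δ, γ+δ+1, …, γ+2δ}. -/
theorem gray_add_of_torsion (p : ℕ) (hp : p.Prime) (u v : ZMod (p ^ 2)) (h : p • u = 0) :
    gray p (u + v) = gray p u + gray p v := by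
  have : NeZero p := ⟨hp.ne_zero⟩
  have hu : p ∣ u.val := by
    have h1 : ((p * u.val : ℕ) : ZMod (p ^ 2)) = 0 := by
      rw [Nat.cast_mul, ZMod.natCast_zmod_val, ← nsmul_eq_mul, h]
    rw [ZMod.natCast_eq_zero_iff] at h1
    exact Nat.dvd_of_mul_dvd_mul_left hp.pos ((dvd_of_eq (pow_two p).symm).trans h1)
  obtain ⟨a, ha⟩ := hu
  have h1 : (u + v).val / p = (a + v.val / p) % p := by
    rw [ZMod.val_add, ha]
    generalize v.val = b
    rw [pow_two, Nat.mod_mul_right_div_self, Nat.mul_add_div hp.pos]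
  have h2 : (u + v).val % p = v.val % p := by
    rw [ZMod.val_add, ha]
    generalize v.val = b
    rw [pow_two, Nat.mod_mul_right_mod, Nat.mul_add_mod]
  funext i
  simp only [gray, Pi.add_apply, h1, h2, ha]
  rw [Nat.mul_div_cancel_left _ hp.pos, Nat.mul_mod_right, ZMod.natCast_mod]
  push_cast
  ring

theorem gray_inj (p : ℕ) (hp : p.Prime) : Function.Injective (gray p) := by
  have : NeZero p := ⟨hp.ne_zero⟩
  intro u v h
  have h0 := congrFun h ⟨0, hp.pos⟩
  have h1 := congrFun h ⟨1, hp.one_lt⟩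
  simp only [gray, Nat.cast_zero, mul_zero, add_zero, Nat.cast_one, mul_one] at h0 h1
  rw [h0, add_right_inj] at h1
  have key : ∀ w : ZMod (p ^ 2), w.val / p < p := fun w => by
    rw [Nat.div_lt_iff_lt_mul hp.pos]; exact (ZMod.val_lt w).trans_eq (pow_two p)
  rw [ZMod.natCast_eq_natCast_iff', Nat.mod_eq_of_lt (key _), Nat.mod_eq_of_lt (key _)] at h0
  rw [ZMod.natCast_eq_natCast_iff', Nat.mod_mod, Nat.mod_mod] at h1
  apply ZMod.val_injective
  rw [← Nat.div_add_mod u.val p, ← Nat.div_add_mod v.val p, h0, h1]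

theorem Gray_inj (p : ℕ) (hp : p.Prime) (α β : ℕ) : Function.Injective (Gray p α β) := by
  intro u v h
  simp only [Gray, Prod.mk.injEq] at h
  exact Prod.ext h.1 (funext fun j => gray_inj p hp (congrFun h.2 j))

theorem Gray_add_of_torsion (p : ℕ) (hp : p.Prime) (α β : ℕ)
    (u v : (Fin α → ZMod p) × (Fin β → ZMod (p ^ 2))) (h : p • u = 0) :
    Gray p α β (u + v) = Gray p α β u + Gray p α β v := by
  refine Prod.ext rfl (funext fun j => ?_)
  exact gray_add_of_torsion p hp _ _ (congrFun (congrArg Prod.snd h) j)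

theorem Gray_mem_kernel (p : ℕ) (hp : p.Prime) (α β : ℕ)
    (𝒞 : AddSubgroup ((Fin α → ZMod p) × (Fin β → ZMod (p ^ 2))))
    (u : (Fin α → ZMod p) × (Fin β → ZMod (p ^ 2))) (hu : u ∈ 𝒞) (h : p • u = 0) :
    Gray p α β u ∈ kernelSet
      (Gray p α β '' (𝒞 : Set ((Fin α → ZMod p) × (Fin β → ZMod (p ^ 2))))) := by
  show _ = _
  ext x
  constructor
  · rintro ⟨_, ⟨v, hv, rfl⟩, rfl⟩
    exact ⟨u + v, 𝒞.add_mem hu hv, Gray_add_of_torsion p hp α β u v h⟩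
  · rintro ⟨v, hv, rfl⟩
    refine ⟨_, ⟨v - u, 𝒞.sub_mem hv hu, rfl⟩, ?_⟩
    show Gray p α β u + _ = _
    rw [← Gray_add_of_torsion p hp α β u _ h, add_sub_cancel]

/-- The kernel dimension bounds: `p^(γ+δ) ≤ |K(C)| ≤ p^(γ+2δ)`. -/
theorem kernel_card_bounds (p : ℕ) (hp : p.Prime) (hodd : Odd p) (α β γ δ : ℕ)
    (𝒞 : AddSubgroup ((Fin α → ZMod p) × (Fin β → ZMod (p ^ 2))))
    (e : 𝒞 ≃+ (Fin γ → ZMod p) × (Fin δ → ZMod (p ^ 2))) :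
    p ^ (γ + δ) ≤
        Nat.card
          (kernelSet (Gray p α β '' (𝒞 : Set ((Fin α → ZMod p) × (Fin β → ZMod (p ^ 2)))))) ∧
      Nat.card
          (kernelSet (Gray p α β '' (𝒞 : Set ((Fin α → ZMod p) × (Fin β → ZMod (p ^ 2)))))) ≤
        p ^ (γ + 2 * δ) := by
  have : NeZero p := ⟨hp.ne_zero⟩
  constructor
  · let t : (Fin γ → ZMod p) × (Fin δ → ZMod p) → (Fin γ → ZMod p) × (Fin δ → ZMod (p ^ 2)) :=
      fun x => (x.1, fun j => ((p * (x.2 j).val : ℕ) : ZMod (p ^ 2)))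
    have ht : ∀ x, p • t x = 0 := by
      intro x
      refine Prod.ext (funext fun j => ?_) (funext fun j => ?_)
      · simp [t]
      · show p • ((p * (x.2 j).val : ℕ) : ZMod (p ^ 2)) = 0
        rw [nsmul_eq_mul, ← Nat.cast_mul, ZMod.natCast_eq_zero_iff]
        exact ⟨(x.2 j).val, by ring⟩
    have hti : Function.Injective t := by
      intro x y h
      simp only [t, Prod.mk.injEq] at h
      refine Prod.ext h.1 (funext fun j => ?_)
      have h2 := congrFun h.2 j
      have lt : ∀ a : ZMod p, p * a.val < p ^ 2 := fun a => by
        rw [pow_two]; exact Nat.mul_lt_mul_of_pos_left (ZMod.val_lt a) hp.pos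
      rw [ZMod.natCast_eq_natCast_iff', Nat.mod_eq_of_lt (lt _), Nat.mod_eq_of_lt (lt _)] at h2
      exact ZMod.val_injective p (Nat.eq_of_mul_eq_mul_left hp.pos h2)
    have hk : ∀ x, Gray p α β (e.symm (t x)) ∈ kernelSet
        (Gray p α β '' (𝒞 : Set ((Fin α → ZMod p) × (Fin β → ZMod (p ^ 2))))) := by
      intro x
      refine Gray_mem_kernel p hp α β 𝒞 _ (e.symm (t x)).2 ?_
      have : p • e.symm (t x) = 0 := by rw [← map_nsmul, ht, map_zero]
      simpa using congrArg Subtype.val this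
    have := Nat.card_le_card_of_injective
      (fun x => (⟨_, hk x⟩ : kernelSet
        (Gray p α β '' (𝒞 : Set ((Fin α → ZMod p) × (Fin β → ZMod (p ^ 2))))))) (by
        intro x y h
        exact hti (e.symm.injective (Subtype.ext (Gray_inj p hp α β (congrArg Subtype.val h)))))
    refine le_trans (le_of_eq ?_) this
    simp [Nat.card_prod, pow_add]
  · have hsub : kernelSet (Gray p α β '' (𝒞 : Set ((Fin α → ZMod p) × (Fin β → ZMod (p ^ 2))))) ⊆
        Gray p α β '' (𝒞 : Set ((Fin α → ZMod p) × (Fin β → ZMod (p ^ 2)))) := by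
      intro x hx
      have h0 : Gray p α β 0 = 0 := by
        have := Gray_add_of_torsion p hp α β 0 0 (smul_zero _)
        simpa using this
      have hx' : (fun c => x + c) '' _ = _ := hx
      rw [← hx']
      exact ⟨0, ⟨0, 𝒞.zero_mem, h0⟩, add_zero x⟩
    refine (Nat.card_mono (Set.toFinite _) hsub).trans ?_
    refine (le_of_eq (Nat.card_image_of_injective (Gray_inj p hp α β) _)).trans (le_of_eq ?_)
    refine (Nat.card_congr e.toEquiv).trans ?_
    simp [Nat.card_prod, pow_add, pow_mul]
end
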